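/- Fix integers n ≥ 1 and degrees d₁, …, dₙ ≥ 1, and let D = d₁·d₂·⋯·dₙ. Let f = (f₁, …, fₙ) be a random system of real homogeneous polynomials in X₀, …, Xₙ, where fᵢ = Σ_{|α|=dᵢ} binom(dᵢ, α)^{1/2} · a_α^{(i)} · X^α and all the coefficients a_α^{(i)} are independent standard real Gaussian random variables (this is the standard Gaussian with respect to the Bombieri–Weyl basis). Then the expected number of zeros of f in the real projective space ℝP^n equals √D = √(d₁⋯dₙ). -/

import Mathlib

open MeasureTheory

/-- The random Bombieri–Weyl polynomial system: given degrees `d : Fin n → ℕ` and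
coefficients `a`, the `i`-th polynomial evaluated at `x ∈ ℝ^{n+1}` is
`Σ_{|α|=dᵢ} binom(dᵢ,α)^{1/2} a_α^{(i)} x^α`, where monomials of degree `dᵢ` are indexed by
multisets `m ∈ Sym (Fin (n+1)) (dᵢ)` (the exponent of the variable `k` is the multiplicity
of `k` in `m`). -/
noncomputable def bwSystem {n : ℕ} (d : Fin n → ℕ)
    (a : (i : Fin n) → Sym (Fin (n + 1)) (d i) → ℝ) (x : Fin (n + 1) → ℝ) (i : Fin n) : ℝ :=
  ∑ m : Sym (Fin (n + 1)) (d i),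
    Real.sqrt (Nat.multinomial Finset.univ fun k => Multiset.count k (m : Multiset (Fin (n + 1)))) *
      a i m * ∏ k, x k ^ Multiset.count k (m : Multiset (Fin (n + 1)))

open MeasureTheory

theorem lintegral_pi_prod_fin : ∀ (n : ℕ) {E : Fin n → Type} [∀ i, MeasurableSpace (E i)]
    (μ : ∀ i, Measure (E i)) [∀ i, SigmaFinite (μ i)] (f : ∀ i, E i → ENNReal)
    (_ : ∀ i, Measurable (f i)),
    ∫⁻ x, ∏ i, f i (x i) ∂(Measure.pi μ) = ∏ i, ∫⁻ x, f i x ∂(μ i) := by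
  intro n
  induction n with
  | zero => intro E _ μ _ f hf; simp
  | succ n ih =>
    intro E _ μ _ f hf
    have h := (measurePreserving_piFinSuccAbove μ 0).symm
    rw [← h.lintegral_comp_emb (MeasurableEquiv.measurableEmbedding _), Fin.prod_univ_succ]
    have := ih (fun j => μ (Fin.succ j)) (fun j => f (Fin.succ j)) (fun j => hf _)
    rw [← this, ← lintegral_prod_mul (hf 0).aemeasurable]
    · apply lintegral_congr
      intro x
      rw [Fin.prod_univ_succ]
      rfl
    · apply Measurable.aemeasurable
      apply Finset.measurable_prod
      intro i _
      exact (hf _).comp (measurable_pi_apply i)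

theorem pi_withDensity_fin (n : ℕ) {E : Fin n → Type} [∀ i, MeasurableSpace (E i)]
    (μ : ∀ i, Measure (E i)) [∀ i, SigmaFinite (μ i)] (f : ∀ i, E i → ENNReal)
    (hf : ∀ i, Measurable (f i)) [∀ i, SigmaFinite ((μ i).withDensity (f i))] :
    Measure.pi (fun i => (μ i).withDensity (f i))
      = (Measure.pi μ).withDensity (fun x => ∏ i, f i (x i)) := by
  apply Measure.pi_eq
  intro s hs
  rw [withDensity_apply _ (MeasurableSet.univ_pi hs), ← lintegral_indicator (MeasurableSet.univ_pi hs)]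
  have : ∀ x : (∀ i, E i), (Set.univ.pi s).indicator (fun x => ∏ i, f i (x i)) x
      = ∏ i, (s i).indicator (f i) (x i) := by
    intro x
    by_cases hx : x ∈ Set.univ.pi s
    · rw [Set.indicator_of_mem hx]
      refine Finset.prod_congr rfl fun i _ => ?_
      rw [Set.indicator_of_mem (hx i trivial)]
    · rw [Set.indicator_of_notMem hx]
      simp only [Set.mem_pi, Set.mem_univ, true_imp_iff, not_forall] at hx
      obtain ⟨i, hi⟩ := hx
      symm
      apply Finset.prod_eq_zero (Finset.mem_univ i)
      rw [Set.indicator_of_notMem hi]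
  simp_rw [this]
  rw [lintegral_pi_prod_fin n μ _ (fun i => (hf i).indicator (hs i))]
  refine Finset.prod_congr rfl fun i _ => ?_
  rw [lintegral_indicator (hs i), withDensity_apply _ (hs i)]

/-- Resampling one coordinate. -/
theorem mp_update {ι : Type} [Fintype ι] [DecidableEq ι] (μ : Measure ℝ) [IsProbabilityMeasure μ]
    (m0 : ι) :
    MeasurePreserving (fun p : ℝ × (ι → ℝ) => Function.update p.2 m0 p.1)
      (μ.prod (Measure.pi fun _ : ι => μ)) (Measure.pi fun _ : ι => μ) := by
  have hm : Measurable (fun p : ℝ × (ι → ℝ) => Function.update p.2 m0 p.1) := by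
    rw [measurable_pi_iff]
    intro i
    by_cases h : i = m0
    · subst h; simpa using measurable_fst
    · simp only [Function.update_of_ne h]; fun_prop
  refine ⟨hm, ?_⟩
  symm
  apply Measure.pi_eq
  intro s hs
  rw [Measure.map_apply hm (MeasurableSet.univ_pi hs)]
  have : (fun p : ℝ × (ι → ℝ) => Function.update p.2 m0 p.1) ⁻¹' (Set.univ.pi s)
      = (s m0) ×ˢ (Set.univ.pi (Function.update s m0 Set.univ)) := by
    ext ⟨c, a⟩
    simp only [Set.mem_preimage, Set.mem_pi, Set.mem_univ, true_imp_iff, Set.mem_prod]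
    constructor
    · intro h
      refine ⟨by simpa using h m0, fun i => ?_⟩
      by_cases hi : i = m0
      · subst hi; simp
      · simpa [hi] using h i
    · rintro ⟨h1, h2⟩ i
      by_cases hi : i = m0
      · subst hi; simpa using h1
      · simpa [hi] using h2 i
  rw [this, Measure.prod_prod, Measure.pi_pi, ← Finset.mul_prod_erase _ _ (Finset.mem_univ m0),
    ← Finset.mul_prod_erase _ (fun i => μ (s i)) (Finset.mem_univ m0)]
  simp only [Function.update_self, measure_univ, one_mul]
  congr 1
  refine Finset.prod_congr rfl fun i hi => ?_
  rw [Function.update_of_ne (Finset.ne_of_mem_erase hi)]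

/-- pairing -/
theorem mp_pair (n : ℕ) {E : Fin n → Type} [∀ i, MeasurableSpace (E i)]
    (μ : Measure ℝ) [IsProbabilityMeasure μ]
    (ν : ∀ i, Measure (E i)) [∀ i, IsProbabilityMeasure (ν i)] :
    MeasurePreserving (fun p : (Fin n → ℝ) × (∀ i, E i) => fun i => (p.1 i, p.2 i))
      ((Measure.pi fun _ => μ).prod (Measure.pi ν)) (Measure.pi fun i => μ.prod (ν i)) := by
  have hm : Measurable (fun p : (Fin n → ℝ) × (∀ i, E i) => fun i => (p.1 i, p.2 i)) := by
    fun_prop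
  refine ⟨hm, ?_⟩
  symm
  refine Measure.pi_eq_generateFrom (C := fun i => Set.image2 (· ×ˢ ·) {s : Set ℝ | MeasurableSet s}
      {t : Set (E i) | MeasurableSet t})
    (fun i => generateFrom_prod) (fun i => isPiSystem_prod) (fun i => ?_) ?_
  · refine ⟨fun _ => Set.univ, fun _ => ⟨Set.univ, by simp, Set.univ, by simp, by simp⟩, fun _ => measure_lt_top _ _, by simp [Set.iUnion_const]⟩
  · intro s hs
    choose u hu v hv h using hs
    have hu : ∀ i, MeasurableSet (u i) := fun i => by simpa using hu i
    have hv : ∀ i, MeasurableSet (v i) := fun i => by simpa using hv i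
    obtain rfl : s = fun i => u i ×ˢ v i := funext fun i => (h i).symm
    rw [Measure.map_apply hm (MeasurableSet.univ_pi fun i => (hu i).prod (hv i))]
    have : (fun p : (Fin n → ℝ) × (∀ i, E i) => fun i => (p.1 i, p.2 i)) ⁻¹' (Set.univ.pi fun i => u i ×ˢ v i)
      = (Set.univ.pi u) ×ˢ (Set.univ.pi v) := by
      ext ⟨c, a⟩
      simp [Set.mem_pi, forall_and]
    rw [this, Measure.prod_prod, Measure.pi_pi, Measure.pi_pi, ← Finset.prod_mul_distrib]
    simp [Measure.prod_prod]

/-- Resampling one coordinate in each block. -/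
theorem mp_update_all (n : ℕ) {ι : Fin n → Type} [∀ i, Fintype (ι i)] [∀ i, DecidableEq (ι i)]
    (μ : Measure ℝ) [IsProbabilityMeasure μ] (m0 : ∀ i, ι i) :
    MeasurePreserving (fun p : (Fin n → ℝ) × (∀ i, ι i → ℝ) => fun i =>
        Function.update (p.2 i) (m0 i) (p.1 i))
      ((Measure.pi fun _ => μ).prod (Measure.pi fun i => Measure.pi fun _ : ι i => μ))
      (Measure.pi fun i => Measure.pi fun _ : ι i => μ) := by
  have h1 := mp_pair n μ (fun i => Measure.pi fun _ : ι i => μ)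
  have h2 := measurePreserving_pi (fun i => μ.prod (Measure.pi fun _ : ι i => μ))
    (fun i => Measure.pi fun _ : ι i => μ) (f := fun i p => Function.update p.2 (m0 i) p.1)
    (fun i => mp_update μ (m0 i))
  exact h2.comp h1

open MeasureTheory

theorem toENNReal_encard_eq_tsum {α : Type} (s : ℕ → Set α) (hs : Pairwise (Function.onFun Disjoint s)) :
    ((⋃ k, s k).encard : ENNReal) = ∑' k, ((s k).encard : ENNReal) := by
  let _ : MeasurableSpace α := ⊤
  have h : ∀ t : Set α, (t.encard : ENNReal) = Measure.count t := fun t =>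
    (Measure.count_apply (by trivial)).symm
  simp_rw [h]
  exact measure_iUnion hs (fun _ => trivial)

section
variable {E : Type} [NormedAddCommGroup E] [NormedSpace ℝ E] [FiniteDimensional ℝ E]
  [MeasurableSpace E] [BorelSpace E] (μ : Measure E) [μ.IsAddHaarMeasure]

theorem area_formula_multiplicity (f : E → E) (f' : E → E →L[ℝ] E)
    (hf : ∀ x, HasStrictFDerivAt f (f' x) x)
    (hcont : Continuous f') (g : E → ENNReal) (hg : Measurable g) :
    ∫⁻ y, ((f ⁻¹' {y}).encard : ENNReal) * g y ∂μ
      = ∫⁻ x, ENNReal.ofReal |(f' x).det| * g (f x) ∂μ := by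
  classical
  have hfc : Continuous f := continuous_iff_continuousAt.2 fun x => (hf x).continuousAt
  have hdc : Continuous fun x => (f' x).det := ContinuousLinearMap.continuous_det.comp hcont
  set R : Set E := {x | (f' x).det ≠ 0} with hR
  have hRo : IsOpen R := isOpen_ne_fun hdc continuous_const
  -- local injectivity
  have hloc : ∀ x : R, ∃ u : Set E, IsOpen u ∧ x.1 ∈ u ∧ Set.InjOn f u := by
    rintro ⟨x, hx⟩
    have he : HasStrictFDerivAt f
        (((f' x).toContinuousLinearEquivOfDetNeZero hx : E ≃L[ℝ] E) : E →L[ℝ] E) x := by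
      simpa using hf x
    refine ⟨_, (he.toOpenPartialHomeomorph f).open_source, he.mem_toOpenPartialHomeomorph_source, ?_⟩
    exact (he.toOpenPartialHomeomorph f).injOn
  choose u huo hxu huinj using hloc
  obtain ⟨T, hTc, hT⟩ := TopologicalSpace.isOpen_iUnion_countable u huo
  have hcov : R ⊆ ⋃ i ∈ T, u i := by
    rw [hT]
    intro x hx
    exact Set.mem_iUnion.2 ⟨⟨x, hx⟩, hxu _⟩
  -- enumerate
  obtain ⟨v, hvm, hvinj, hvcov⟩ : ∃ v : ℕ → Set E, (∀ k, MeasurableSet (v k)) ∧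
      (∀ k, Set.InjOn f (v k)) ∧ R ⊆ ⋃ k, v k := by
    rcases T.eq_empty_or_nonempty with h | h
    · refine ⟨fun _ => ∅, fun _ => MeasurableSet.empty, fun _ => Set.injOn_empty _, ?_⟩
      simpa [h] using hcov
    · obtain ⟨e, he⟩ := hTc.exists_eq_range h
      refine ⟨fun k => u (e k), fun k => (huo _).measurableSet, fun k => huinj _, ?_⟩
      intro x hx
      have := hcov hx
      simp only [Set.mem_iUnion, exists_prop] at this ⊢
      obtain ⟨i, hi, hxi⟩ := this
      rw [he] at hi
      obtain ⟨k, rfl⟩ := hi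
      exact ⟨k, hxi⟩
  set w : ℕ → Set E := fun k => disjointed v k ∩ R with hw
  have hwd : Pairwise (Function.onFun Disjoint w) := fun i j hij =>
    (disjoint_disjointed v hij).mono Set.inter_subset_left Set.inter_subset_left
  have hwm : ∀ k, MeasurableSet (w k) := fun k =>
    (MeasurableSet.disjointed hvm k).inter hRo.measurableSet
  have hwinj : ∀ k, Set.InjOn f (w k) := fun k => (hvinj k).mono
    (Set.inter_subset_left.trans (disjointed_subset v k))
  have hwR : ⋃ k, w k = R := by
    rw [hw, ← Set.iUnion_inter, iUnion_disjointed]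
    exact Set.inter_eq_right.2 hvcov
  -- critical values
  have hcrit : μ (f '' Rᶜ) = 0 := by
    apply addHaar_image_eq_zero_of_det_fderivWithin_eq_zero μ (f' := f')
      (fun x _ => (hf x).hasFDerivAt.hasFDerivWithinAt)
    intro x hx
    simpa [hR] using hx
  have hae : ∀ᵐ y ∂μ, y ∉ f '' Rᶜ := measure_eq_zero_iff_ae_notMem.1 hcrit
  have h1 : ∀ᵐ y ∂μ, ((f ⁻¹' {y}).encard : ENNReal) * g y
      = ∑' k, (f '' w k).indicator g y := by
    filter_upwards [hae] with y hy
    have : f ⁻¹' {y} = ⋃ k, (w k ∩ f ⁻¹' {y}) := by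
      rw [← Set.iUnion_inter, hwR]
      symm
      apply Set.inter_eq_right.2
      intro x hx
      by_contra hxR
      exact hy ⟨x, hxR, hx⟩
    rw [this, toENNReal_encard_eq_tsum _ (fun i j hij =>
      (hwd hij).mono Set.inter_subset_left Set.inter_subset_left), ← ENNReal.tsum_mul_right]
    congr 1
    ext k
    by_cases hk : y ∈ f '' w k
    · rw [Set.indicator_of_mem hk]
      obtain ⟨x, hx, hxy⟩ := hk
      have : w k ∩ f ⁻¹' {y} = {x} := by
        ext z
        simp only [Set.mem_inter_iff, Set.mem_preimage, Set.mem_singleton_iff]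
        constructor
        · rintro ⟨h1, h2⟩
          exact hwinj k h1 hx (h2.trans hxy.symm)
        · rintro rfl
          exact ⟨hx, hxy⟩
      simp [this]
    · rw [Set.indicator_of_notMem hk]
      have : w k ∩ f ⁻¹' {y} = ∅ := by
        ext z
        simp only [Set.mem_inter_iff, Set.mem_preimage, Set.mem_singleton_iff, Set.mem_empty_iff_false,
          iff_false, not_and]
        intro h1 h2
        exact hk ⟨z, h1, h2⟩
      simp [this]
  have himm : ∀ k, MeasurableSet (f '' w k) := fun k =>
    measurable_image_of_fderivWithin (hwm k)
      (fun x _ => (hf x).hasFDerivAt.hasFDerivWithinAt) (hwinj k)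
  rw [lintegral_congr_ae h1, lintegral_tsum (fun k => (hg.indicator (himm k)).aemeasurable)]
  have h2 : ∀ k, ∫⁻ y, (f '' w k).indicator g y ∂μ
      = ∫⁻ x in w k, ENNReal.ofReal |(f' x).det| * g (f x) ∂μ := by
    intro k
    rw [lintegral_indicator (himm k)]
    exact lintegral_image_eq_lintegral_abs_det_fderiv_mul μ (hwm k)
      (fun x _ => (hf x).hasFDerivAt.hasFDerivWithinAt) (hwinj k) g
  simp_rw [h2]
  rw [← lintegral_iUnion hwm hwd, hwR]
  rw [← lintegral_indicator hRo.measurableSet]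
  apply lintegral_congr
  intro x
  by_cases hx : x ∈ R
  · rw [Set.indicator_of_mem hx]
  · rw [Set.indicator_of_notMem hx]
    have : (f' x).det = 0 := by simpa [hR] using hx
    simp [this]
end

open MeasureTheory

theorem exists_compact_net (E : Type) [PseudoMetricSpace E] [ProperSpace E] [Nonempty E] 
    [TopologicalSpace.SeparableSpace E] :
    ∃ K : ℕ × ℕ → Set E, (∀ k, IsCompact (K k)) ∧
      ∀ x : E, ∀ U, IsOpen U → x ∈ U → ∃ k, x ∈ K k ∧ K k ⊆ U := by
  refine ⟨fun k => Metric.closedBall (TopologicalSpace.denseSeq E k.1) (1 / ((k.2 : ℝ) + 1)),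
    fun k => isCompact_closedBall _ _, ?_⟩
  intro x U hU hx
  obtain ⟨ε, hε, hb⟩ := Metric.isOpen_iff.1 hU x hx
  obtain ⟨j, hj⟩ := exists_nat_one_div_lt (half_pos hε)
  have hjp : 0 < 1 / ((j : ℝ) + 1) := by positivity
  obtain ⟨i, hi⟩ := (TopologicalSpace.denseRange_denseSeq E).exists_dist_lt x hjp
  refine ⟨(i, j), ?_, ?_⟩
  · simp only [Metric.mem_closedBall]; exact hi.le
  · intro y hy
    apply hb
    simp only [Metric.mem_closedBall] at hy
    rw [Metric.mem_ball]
    have := dist_triangle y (TopologicalSpace.denseSeq E i) x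
    rw [dist_comm (TopologicalSpace.denseSeq E i) x] at this
    linarith

theorem measurable_encard_zeros {A E F : Type} [TopologicalSpace A] [MeasurableSpace A] [BorelSpace A]
    [MetricSpace E] [ProperSpace E] [Nonempty E] [TopologicalSpace F] [T1Space F]
    [Zero F] (G : A → E → F) (hG : Continuous fun p : A × E => G p.1 p.2) :
    Measurable fun a => (({t | G a t = 0}.encard : ℕ∞) : ENNReal) := by
  classical
  obtain ⟨K, hK, hKn⟩ := exists_compact_net E
  have hC : ∀ k, MeasurableSet {a | ∃ t ∈ K k, G a t = 0} := by
    intro k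
    apply IsClosed.measurableSet
    have : CompactSpace (K k) := isCompact_iff_compactSpace.1 (hK k)
    have h1 : IsClosed {p : A × K k | G p.1 p.2 = 0} :=
      isClosed_singleton.preimage (f := fun p : A × K k => G p.1 p.2)
        (hG.comp (continuous_fst.prodMk (continuous_subtype_val.comp continuous_snd)))
    have h2 := isClosedMap_fst_of_compactSpace _ h1
    convert h2 using 1
    ext a
    simp
  have key : (fun a => (({t | G a t = 0}.encard : ℕ∞) : ENNReal)) = fun a =>
      ⨆ S : Finset (ℕ × ℕ), ({a | (S : Set (ℕ × ℕ)).PairwiseDisjoint K ∧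
        ∀ k ∈ S, a ∈ {a | ∃ t ∈ K k, G a t = 0}}).indicator (fun _ => (S.card : ENNReal)) a := by
    funext a
    apply le_antisymm
    · have : ∀ m : ℕ, (m : ℕ∞) ≤ {t | G a t = 0}.encard → (m : ENNReal) ≤ 
        ⨆ S : Finset (ℕ × ℕ), ({a | (S : Set (ℕ × ℕ)).PairwiseDisjoint K ∧
        ∀ k ∈ S, a ∈ {a | ∃ t ∈ K k, G a t = 0}}).indicator (fun _ => (S.card : ENNReal)) a := by
        intro m hm
        obtain ⟨t, ht, htc⟩ := Set.exists_subset_encard_eq hm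
        have htf : t.Finite := Set.finite_of_encard_eq_coe htc
        obtain ⟨U, hU, hUd⟩ := htf.t2_separation
        choose k hk1 hk2 using fun x => hKn x (U x) (hU x).2 (hU x).1
        have hinj : Set.InjOn k t := by
          intro x hx y hy hxy
          by_contra hne
          have := hUd hx hy hne
          exact Set.disjoint_left.1 this (hk2 x (hk1 x)) (hk2 y (hxy ▸ hk1 x))
        refine le_trans (le_of_eq ?_) (le_iSup _ (htf.toFinset.image k))
        rw [Set.indicator_of_mem]
        · rw [Finset.card_image_of_injOn (by simpa using hinj)]
          rw [htf.encard_eq_coe_toFinset_card] at htc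
          have : htf.toFinset.card = m := by exact_mod_cast htc
          rw [this]
        · refine ⟨?_, ?_⟩
          · intro p hp q hq hpq
            simp only [Finset.coe_image, Set.Finite.coe_toFinset, Set.mem_image] at hp hq
            obtain ⟨x, hx, rfl⟩ := hp
            obtain ⟨y, hy, rfl⟩ := hq
            have : x ≠ y := fun h => hpq (by rw [h])
            exact (hUd hx hy this).mono (hk2 x) (hk2 y)
          · intro p hp
            simp only [Finset.mem_image, Set.Finite.mem_toFinset] at hp
            obtain ⟨x, hx, rfl⟩ := hp
            exact ⟨x, hk1 x, ht hx⟩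
      by_cases htop : {t | G a t = 0}.encard = ⊤
      · rw [htop]
        simp only [ENat.toENNReal_top, top_le_iff]
        refine ENNReal.eq_top_of_forall_nnreal_le fun r => ?_
        obtain ⟨m, hm⟩ := exists_nat_ge r
        refine le_trans ?_ (this m (by rw [htop]; exact le_top))
        exact_mod_cast hm
      · obtain ⟨m, hm⟩ := ENat.ne_top_iff_exists.1 htop
        have h := this m hm.le
        rw [← hm]
        simpa using h
    · apply iSup_le
      intro S
      by_cases h : a ∈ {a | (S : Set (ℕ × ℕ)).PairwiseDisjoint K ∧
        ∀ k ∈ S, a ∈ {a | ∃ t ∈ K k, G a t = 0}}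
      · rw [Set.indicator_of_mem h]
        obtain ⟨h1, h2⟩ := h
        choose! z hz1 hz2 using h2
        have hinj : Set.InjOn z S := by
          intro p hp q hq hpq
          by_contra hne
          exact Set.disjoint_left.1 (h1 hp hq hne) (hz1 p hp) (hpq ▸ hz1 q hq)
        have h3 : (z '' (S : Set (ℕ × ℕ))) ⊆ {t | G a t = 0} := by
          rintro _ ⟨p, hp, rfl⟩
          exact hz2 p hp
        have h4 := Set.encard_le_encard h3
        rw [hinj.encard_image, Set.encard_coe_eq_coe_finsetCard] at h4
        have := ENat.toENNReal_le.2 h4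
        simpa using this
      · rw [Set.indicator_of_notMem h]
        exact zero_le
  rw [key]
  apply Measurable.iSup
  intro S
  apply measurable_const.indicator
  apply MeasurableSet.inter
  · exact MeasurableSet.const _
  · have : {a | ∀ k ∈ S, a ∈ {a | ∃ t ∈ K k, G a t = 0}} = ⋂ k ∈ S, {a | ∃ t ∈ K k, G a t = 0} := by
      ext; simp
    show MeasurableSet {a | ∀ k ∈ S, a ∈ {a | ∃ t ∈ K k, G a t = 0}}
    rw [this]
    exact S.measurableSet_biInter fun k _ => hC k

open MeasureTheory ProbabilityTheory

theorem gauss_char {ι : Type} [Fintype ι] (c : ι → ℝ) :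
    ∫ b : ι → ℝ, Complex.exp ((∑ m, c m * b m : ℝ) * Complex.I)
      ∂(Measure.pi fun _ : ι => gaussianReal 0 1) = Complex.exp ((-(∑ m, c m ^ 2) / 2 : ℝ)) := by
  have h1 : ∀ b : ι → ℝ, Complex.exp ((∑ m, c m * b m : ℝ) * Complex.I)
      = ∏ m, Complex.exp (c m * b m * Complex.I) := by
    intro b
    rw [← Complex.exp_sum, Complex.ofReal_sum, Finset.sum_mul]
    simp
  simp_rw [h1]
  rw [integral_fintype_prod_eq_prod (𝕜 := ℂ) (fun m (x : ℝ) => Complex.exp (c m * x * Complex.I))]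
  simp_rw [← charFun_apply_real, charFun_gaussianReal]
  rw [← Complex.exp_sum]
  congr 1
  push_cast
  simp [Finset.sum_div, neg_div]

theorem gauss_quad (A B C : ℝ) (hA : 0 ≤ A) :
    ∫ η : ℝ, Complex.exp ((-(η ^ 2 * A + 2 * η * B + C) / 2 : ℝ)) ∂(gaussianReal 0 1)
      = ((√(1 + A))⁻¹ * Real.exp (-(C - B ^ 2 / (1 + A)) / 2) : ℝ) := by
  rw [integral_gaussianReal_eq_integral_smul one_ne_zero]
  have h1 : ∀ η : ℝ, gaussianPDFReal 0 1 η • Complex.exp ((-(η ^ 2 * A + 2 * η * B + C) / 2 : ℝ))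
      = ((√(2 * Real.pi))⁻¹ : ℝ) * Complex.exp ((-(1 + A) / 2 : ℝ) * (η : ℂ) ^ 2 + (-B : ℝ) * η + (- C / 2 : ℝ)) := by
    intro η
    rw [Complex.real_smul, gaussianPDFReal]
    push_cast
    rw [mul_assoc, ← Complex.exp_add]
    congr 2
    · simp
    · ring
  simp_rw [h1]
  rw [integral_const_mul, integral_cexp_quadratic (by rw [Complex.ofReal_re]; linarith)]
  have h2 : ((Real.pi : ℂ) / -((-(1 + A) / 2 : ℝ) : ℂ)) ^ (1 / 2 : ℂ)
      = ((√(2 * Real.pi) * (√(1 + A))⁻¹ : ℝ) : ℂ) := by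
    have : ((Real.pi : ℂ) / -((-(1 + A) / 2 : ℝ) : ℂ)) = ((2 * Real.pi / (1 + A) : ℝ) : ℂ) := by
      have h0 : (1 + A : ℂ) ≠ 0 := by
        have : (1 + A : ℝ) ≠ 0 := by positivity
        exact_mod_cast this
      push_cast
      field_simp
    rw [this, show (1 / 2 : ℂ) = ((1 / 2 : ℝ) : ℂ) by simp, ← Complex.ofReal_cpow (by positivity),
      ← Real.sqrt_eq_rpow, Real.sqrt_div' _ (by positivity), div_eq_mul_inv]
  rw [h2]
  have h3 : (√(2 * Real.pi)) ≠ 0 := by positivity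
  have h4 : Complex.exp ((- C / 2 : ℝ) - ((-B : ℝ) : ℂ) ^ 2 / (4 * ((-(1 + A) / 2 : ℝ) : ℂ)))
      = ((Real.exp (-(C - B ^ 2 / (1 + A)) / 2) : ℝ) : ℂ) := by
    rw [Complex.ofReal_exp]
    congr 1
    have h0 : (1 + A : ℝ) ≠ 0 := by positivity
    norm_cast
    field_simp
    ring
  rw [h4, ← Complex.ofReal_mul, ← Complex.ofReal_mul]
  congr 1
  field_simp

/-- The weighted law of a gradient row. -/
noncomputable def rowMeas {n : ℕ} {ι : Type} [Fintype ι] (g : ι → ℝ) (l : Fin n → ι → ℝ) :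
    Measure (Fin n → ℝ) :=
  ((Measure.pi fun _ : ι => gaussianReal 0 1).withDensity
    (fun b => gaussianPDF 0 1 (∑ m, g m * b m))).map (fun b j => ∑ m, l j m * b m)

instance rowDens_finite {ι : Type} [Fintype ι] (g : ι → ℝ) : IsFiniteMeasure ((Measure.pi fun _ : ι => gaussianReal 0 1).withDensity
    (fun b => gaussianPDF 0 1 (∑ m, g m * b m))) := by
  apply isFiniteMeasure_withDensity
  refine ne_of_lt (lt_of_le_of_lt (lintegral_mono (g := fun _ => ENNReal.ofReal (√(2 * Real.pi))⁻¹) ?_) ?_)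
  · intro b
    simp only [gaussianPDF]
    apply ENNReal.ofReal_le_ofReal
    rw [gaussianPDFReal]
    simp only [NNReal.coe_one, mul_one]
    apply mul_le_of_le_one_right (by positivity)
    apply Real.exp_le_one_iff.2
    rw [neg_div, neg_nonpos]; positivity
  · rw [lintegral_const]
    exact ENNReal.mul_lt_top ENNReal.ofReal_lt_top (measure_lt_top _ _)

instance rowMeas_finite {n : ℕ} {ι : Type} [Fintype ι] (g : ι → ℝ) (l : Fin n → ι → ℝ) :
    IsFiniteMeasure (rowMeas g l) := by
  unfold rowMeas; infer_instance

theorem rowMeas_char {n : ℕ} {ι : Type} [Fintype ι] (g : ι → ℝ) (l : Fin n → ι → ℝ) (ξ : Fin n → ℝ) :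
    ∫ x, Complex.exp ((∑ j, ξ j * x j : ℝ) * Complex.I) ∂(rowMeas g l)
      = ((√(2 * Real.pi))⁻¹ * ((√(1 + ∑ m, g m ^ 2))⁻¹ *
        Real.exp (-(∑ m, (∑ j, ξ j * l j m) ^ 2 - (∑ m, g m * ∑ j, ξ j * l j m) ^ 2 / (1 + ∑ m, g m ^ 2)) / 2)) : ℝ) := by
  unfold rowMeas
  rw [integral_map (Measurable.aemeasurable (by fun_prop))
    (Continuous.aestronglyMeasurable (by fun_prop))]
  have hd : Measurable (fun b : ι → ℝ => gaussianPDFReal 0 1 (∑ m, g m * b m)) :=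
    (measurable_gaussianPDFReal 0 1).comp (by fun_prop)
  unfold gaussianPDF
  rw [integral_withDensity_eq_integral_toReal_smul (by fun_prop) (by simp)]
  simp_rw [ENNReal.toReal_ofReal (gaussianPDFReal_nonneg _ _ _)]
  have h1 : ∀ b : ι → ℝ, gaussianPDFReal 0 1 (∑ m, g m * b m) •
      Complex.exp ((∑ j, ξ j * ∑ m, l j m * b m : ℝ) * Complex.I)
      = ((√(2 * Real.pi))⁻¹ : ℝ) * ∫ η : ℝ, Complex.exp ((∑ m, (η * g m + ∑ j, ξ j * l j m) * b m : ℝ) * Complex.I) ∂(gaussianReal 0 1) := by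
    intro b
    have h2 := charFun_gaussianReal (μ := 0) (v := 1) (∑ m, g m * b m)
    rw [charFun_apply_real] at h2
    have h3 : ∀ η : ℝ, Complex.exp ((∑ m, (η * g m + ∑ j, ξ j * l j m) * b m : ℝ) * Complex.I)
      = Complex.exp ((∑ m, g m * b m : ℝ) * η * Complex.I) * Complex.exp ((∑ j, ξ j * ∑ m, l j m * b m : ℝ) * Complex.I) := by
      intro η
      rw [← Complex.exp_add, ← add_mul, ← Complex.ofReal_mul, ← Complex.ofReal_add]
      congr 3
      simp_rw [add_mul, Finset.sum_add_distrib, Finset.sum_mul, Finset.mul_sum]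
      congr 1
      · exact Finset.sum_congr rfl fun _ _ => by ring
      · rw [Finset.sum_comm]
        exact Finset.sum_congr rfl fun _ _ => Finset.sum_congr rfl fun _ _ => by ring
    simp_rw [h3]
    rw [integral_mul_const, h2, gaussianPDFReal, Complex.real_smul, ← mul_assoc]
    congr 1
    push_cast
    simp [neg_div]
  simp_rw [h1]
  rw [integral_const_mul, integral_integral_swap]
  · simp_rw [gauss_char]
    have h4 : ∀ η : ℝ, ∑ m, (η * g m + ∑ j, ξ j * l j m) ^ 2 = η ^ 2 * (∑ m, g m ^ 2) + 2 * η * (∑ m, g m * ∑ j, ξ j * l j m) + ∑ m, (∑ j, ξ j * l j m) ^ 2 := by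
      intro η
      rw [Finset.mul_sum, Finset.mul_sum, ← Finset.sum_add_distrib, ← Finset.sum_add_distrib]
      exact Finset.sum_congr rfl fun _ _ => by ring
    simp_rw [h4]
    rw [gauss_quad _ _ _ (Finset.sum_nonneg fun _ _ => sq_nonneg _), ← Complex.ofReal_mul]
  · apply Integrable.of_bound (C := 1)
    · apply Continuous.aestronglyMeasurable
      simp only [Function.uncurry_def]
      fun_prop
    · filter_upwards with p
      simp only [Function.uncurry_def]
      rw [Complex.norm_exp_ofReal_mul_I]

theorem rowMeas_compare {n : ℕ} {ι ι' : Type} [Fintype ι] [Fintype ι'] (g : ι → ℝ)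
    (l : Fin n → ι → ℝ) (g' : ι' → ℝ) (l' : Fin n → ι' → ℝ) (c lam : ℝ) (hc : 0 ≤ c)
    (h1 : (√(1 + ∑ m, g m ^ 2))⁻¹ = c * (√(1 + ∑ m, g' m ^ 2))⁻¹)
    (h2 : ∀ ξ : Fin n → ℝ, ∑ m, (∑ j, ξ j * l j m) ^ 2 - (∑ m, g m * ∑ j, ξ j * l j m) ^ 2 / (1 + ∑ m, g m ^ 2)
      = lam ^ 2 * (∑ m, (∑ j, ξ j * l' j m) ^ 2 - (∑ m, g' m * ∑ j, ξ j * l' j m) ^ 2 / (1 + ∑ m, g' m ^ 2))) :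
    rowMeas g l = (ENNReal.ofReal c) • (rowMeas g' l').map (fun x => lam • x) := by
  have : IsFiniteMeasure ((ENNReal.ofReal c) • (rowMeas g' l').map (fun x => lam • x)) :=
    Measure.smul_finite _ ENNReal.ofReal_ne_top
  apply Measure.ext_of_charFunDual
  funext L
  rw [charFunDual_apply, charFunDual_apply]
  obtain ⟨ξ, hL⟩ : ∃ ξ : Fin n → ℝ, ∀ x : Fin n → ℝ, L x = ∑ j, ξ j * x j := by
    refine ⟨fun j => L (Pi.single j 1), ?_⟩
    intro x
    conv_lhs => rw [← Finset.univ_sum_single x, map_sum]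
    refine Finset.sum_congr rfl fun j _ => ?_
    have : (Pi.single j (x j) : Fin n → ℝ) = x j • Pi.single j 1 := by
      rw [← Pi.single_smul]; simp
    rw [this, map_smul, smul_eq_mul, mul_comm]
  rw [integral_smul_measure, integral_map (by fun_prop) (by fun_prop)]
  simp_rw [map_smul, smul_eq_mul, hL]
  rw [rowMeas_char g l ξ]
  have h3 : ∀ x : Fin n → ℝ, lam * ∑ j, ξ j * x j = ∑ j, (lam * ξ j) * x j := by
    intro x; rw [Finset.mul_sum]; exact Finset.sum_congr rfl fun _ _ => by ring
  show _ = (ENNReal.ofReal c).toReal • ∫ x, Complex.exp (((lam * ∑ j, ξ j * x j : ℝ) : ℂ) * Complex.I) ∂(rowMeas g' l')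
  simp_rw [h3]
  rw [rowMeas_char g' l' (fun j => lam * ξ j), ENNReal.toReal_ofReal hc, Complex.real_smul, ← Complex.ofReal_mul]
  congr 1
  have h4 : ∀ m, ∑ j, lam * ξ j * l' j m = lam * ∑ j, ξ j * l' j m := by
    intro m; rw [Finset.mul_sum]; exact Finset.sum_congr rfl fun _ _ => by ring
  simp_rw [h4]
  have h5 : ∑ m, g' m * (lam * ∑ j, ξ j * l' j m) = lam * ∑ m, g' m * ∑ j, ξ j * l' j m := by
    rw [Finset.mul_sum]; exact Finset.sum_congr rfl fun _ _ => by ring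
  simp_rw [h5, mul_pow]
  rw [← Finset.mul_sum, mul_div_assoc, ← mul_sub, ← h2 ξ, h1]
  ring

open MeasureTheory ProbabilityTheory

/-- partial derivative -/
noncomputable def pd {n : ℕ} (h : (Fin n → ℝ) → ℝ) (t : Fin n → ℝ) (j : Fin n) : ℝ :=
  fderiv ℝ h t (Pi.single j 1)

theorem pi_gauss_density (n : ℕ) : (Measure.pi fun _ : Fin n => gaussianReal 0 1)
    = (volume : Measure (Fin n → ℝ)).withDensity (fun x => ∏ i, gaussianPDF 0 1 (x i)) := by
  have h : gaussianReal 0 1 = volume.withDensity (gaussianPDF 0 1) :=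
    gaussianReal_of_var_ne_zero _ one_ne_zero
  have : SigmaFinite ((volume : Measure ℝ).withDensity (gaussianPDF 0 1)) := by
    rw [← h]; infer_instance
  rw [h, pi_withDensity_fin n (fun _ => volume) (fun _ => gaussianPDF 0 1)
    (fun _ => measurable_gaussianPDF 0 1)]
  rfl

section
variable {n : ℕ} {ι : Fin n → Type} [∀ i, Fintype (ι i)] [∀ i, DecidableEq (ι i)]

theorem continuous_sys (h : ∀ i, ι i → (Fin n → ℝ) → ℝ) (hh : ∀ i m, Continuous (h i m)) :
    Continuous fun p : (∀ i, ι i → ℝ) × (Fin n → ℝ) => (fun i => ∑ m, h i m p.2 * p.1 i m) := by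
  refine continuous_pi fun i => continuous_finsetSum _ fun m _ => ?_
  have := hh i m
  fun_prop

theorem measurable_count (h : ∀ i, ι i → (Fin n → ℝ) → ℝ) (hh : ∀ i m, Continuous (h i m)) :
    Measurable fun a : (∀ i, ι i → ℝ) =>
      (({t | ∀ i, ∑ m, h i m t * a i m = 0}.encard : ℕ∞) : ENNReal) := by
  have := measurable_encard_zeros (fun (a : ∀ i, ι i → ℝ) (t : Fin n → ℝ) =>
    (fun i => ∑ m, h i m t * a i m)) (continuous_sys h hh)
  simpa only [funext_iff, Pi.zero_apply] using this

theorem kac_rice_fiber (h : ∀ i, ι i → (Fin n → ℝ) → ℝ) (hh : ∀ i m, ContDiff ℝ 1 (h i m))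
    (m0 : ∀ i, ι i) (hm0 : ∀ i t, h i (m0 i) t = 1) (a : ∀ i, ι i → ℝ) :
    ∫⁻ c, (({t | ∀ i, ∑ m, h i m t * Function.update (a i) (m0 i) (c i) m = 0}.encard : ℕ∞) : ENNReal)
      ∂(Measure.pi fun _ : Fin n => gaussianReal 0 1)
    = ∫⁻ t, ENNReal.ofReal |Matrix.det (Matrix.of fun i j => ∑ m, pd (h i m) t j * a i m)| *
        ∏ i, gaussianPDF 0 1 (∑ m, (if m = m0 i then 0 else h i m t) * a i m) := by
  classical
  set f : (Fin n → ℝ) → (Fin n → ℝ) := fun t i => -∑ m, (if m = m0 i then 0 else h i m t) * a i m with hf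
  have hfs : ContDiff ℝ 1 f := by
    rw [contDiff_pi]
    intro i
    apply ContDiff.neg
    apply ContDiff.sum
    intro m _
    by_cases hm : m = m0 i
    · simp only [hm, if_true]; fun_prop
    · simp only [hm, if_false]
      exact (hh i m).mul contDiff_const
  have hset : ∀ c : Fin n → ℝ, {t | ∀ i, ∑ m, h i m t * Function.update (a i) (m0 i) (c i) m = 0}
      = f ⁻¹' {c} := by
    intro c
    ext t
    simp only [Set.mem_ofPred_eq, Set.mem_preimage, Set.mem_singleton_iff, funext_iff, hf]
    refine forall_congr' fun i => ?_
    have : ∑ m, h i m t * Function.update (a i) (m0 i) (c i) m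
        = c i + ∑ m, (if m = m0 i then 0 else h i m t) * a i m := by
      rw [← Finset.add_sum_erase _ _ (Finset.mem_univ (m0 i)),
        ← Finset.add_sum_erase _ (fun m => (if m = m0 i then 0 else h i m t) * a i m)
          (Finset.mem_univ (m0 i))]
      simp only [Function.update_self, hm0, one_mul, if_true, zero_mul, zero_add]
      congr 1
      refine Finset.sum_congr rfl fun m hm => ?_
      have := Finset.ne_of_mem_erase hm
      rw [Function.update_of_ne this, if_neg this]
    rw [this]
    constructor <;> intro h <;> linarith
  simp_rw [hset]
  have hpm : Measurable fun x : Fin n → ℝ => ∏ i, gaussianPDF 0 1 (x i) :=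
    Finset.measurable_prod _ fun i _ => (measurable_gaussianPDF 0 1).comp (measurable_pi_apply i)
  have hcount : Measurable fun c : Fin n → ℝ => (((f ⁻¹' {c}).encard : ℕ∞) : ENNReal) := by
    simp_rw [← hset]
    have h1 := measurable_count h (fun i m => (hh i m).continuous)
    have h2 : Measurable fun c : Fin n → ℝ => fun i => Function.update (a i) (m0 i) (c i) := by
      rw [measurable_pi_iff]; intro i
      exact (measurable_update (a i)).comp (measurable_pi_apply i)
    exact h1.comp h2
  rw [pi_gauss_density, lintegral_withDensity_eq_lintegral_mul _ hpm hcount]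
  simp only [Pi.mul_apply]
  simp_rw [mul_comm (∏ i, gaussianPDF 0 1 _)]
  rw [area_formula_multiplicity volume f (fderiv ℝ f)
    (fun x => hfs.contDiffAt.hasStrictFDerivAt one_ne_zero) (hfs.continuous_fderiv one_ne_zero) _ hpm]
  apply lintegral_congr
  intro t
  congr 1
  · congr 1
    have hfd : ∀ j i, fderiv ℝ f t (Pi.single j 1) i = - ∑ m, pd (h i m) t j * a i m := by
      intro j i
      have hd : DifferentiableAt ℝ f t := hfs.differentiable one_ne_zero t
      have h1 : HasFDerivAt (fun t => f t i) (-∑ m, a i m • fderiv ℝ (h i m) t) t := by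
        apply HasFDerivAt.neg
        apply HasFDerivAt.fun_sum
        intro m _
        by_cases hm : m = m0 i
        · have : h i m = fun _ => 1 := funext fun t => by rw [hm, hm0]
          simp only [hm, if_true]
          have h3 : h i (m0 i) = fun _ => 1 := funext fun t => by rw [hm0]
          rw [h3]
          simpa using hasFDerivAt_const (0 : ℝ) t
        · simp only [hm, if_false]
          exact ((hh i m).differentiable one_ne_zero t).hasFDerivAt.mul_const (a i m)
      have h2 := (hasFDerivAt_pi'.1 hd.hasFDerivAt i).unique h1
      have h3 := congrArg (fun L => L (Pi.single j 1)) h2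
      simp only [ContinuousLinearMap.comp_apply, ContinuousLinearMap.proj_apply] at h3
      rw [h3]
      simp [pd, mul_comm]
    have : (fderiv ℝ f t).det = (-(Matrix.of fun i j => ∑ m, pd (h i m) t j * a i m)).det := by
      rw [ContinuousLinearMap.det, ← LinearMap.det_toMatrix']
      congr 1
      ext i j
      simp [LinearMap.toMatrix'_apply, hfd]
    rw [this, Matrix.det_neg, abs_mul, abs_pow]
    simp
  · refine Finset.prod_congr rfl fun i _ => ?_
    simp [hf, gaussianPDF, gaussianPDFReal]

theorem kac_rice (h : ∀ i, ι i → (Fin n → ℝ) → ℝ) (hh : ∀ i m, ContDiff ℝ 1 (h i m))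
    (m0 : ∀ i, ι i) (hm0 : ∀ i t, h i (m0 i) t = 1) :
    ∫⁻ a, (({t | ∀ i, ∑ m, h i m t * a i m = 0}.encard : ℕ∞) : ENNReal)
      ∂(Measure.pi fun i : Fin n => Measure.pi fun _ : ι i => gaussianReal 0 1)
    = ∫⁻ a, (∫⁻ t, ENNReal.ofReal |Matrix.det (Matrix.of fun i j => ∑ m, pd (h i m) t j * a i m)| *
        ∏ i, gaussianPDF 0 1 (∑ m, (if m = m0 i then 0 else h i m t) * a i m))
        ∂(Measure.pi fun i : Fin n => Measure.pi fun _ : ι i => gaussianReal 0 1) := by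
  have hmp := mp_update_all n (gaussianReal 0 1) m0
  have hm := measurable_count h (fun i m => (hh i m).continuous)
  rw [← hmp.lintegral_comp hm]
  refine (lintegral_prod_symm _ (hm.comp hmp.measurable).aemeasurable).trans ?_
  apply lintegral_congr
  intro a
  exact kac_rice_fiber h hh m0 hm0 a

theorem no_zero (h : ∀ i, ι i → (Fin n → ℝ) → ℝ) (hh : ∀ i m, ContDiff ℝ 1 (h i m))
    (m0 : ∀ i, ι i) (hm0 : ∀ i t, h i (m0 i) t = 1) (j : Fin n)
    (hind : ∀ i m t s, h i m (Function.update t j s) = h i m t) :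
    ∀ᵐ a ∂(Measure.pi fun i : Fin n => Measure.pi fun _ : ι i => gaussianReal 0 1),
      ∀ t, ¬ ∀ i, ∑ m, h i m t * a i m = 0 := by
  have hk := kac_rice h hh m0 hm0
  have hpd : ∀ i m t, pd (h i m) t j = 0 := by
    intro i m t
    have h1 := ((hh i m).differentiable one_ne_zero t).hasFDerivAt.hasLineDerivAt (Pi.single j 1)
    have h2 : HasLineDerivAt ℝ (h i m) 0 t (Pi.single j 1) := by
      unfold HasLineDerivAt
      have : (fun s : ℝ => h i m (t + s • Pi.single j 1)) = fun _ => h i m t := by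
        funext s
        rw [← hind i m t (t j + s)]
        congr 1
        ext k
        by_cases hk : k = j
        · subst hk; simp
        · simp [hk]
      rw [this]
      exact hasDerivAt_const _ _
    exact HasDerivAt.unique h1 h2
  have hz : ∫⁻ a, (({t | ∀ i, ∑ m, h i m t * a i m = 0}.encard : ℕ∞) : ENNReal)
      ∂(Measure.pi fun i : Fin n => Measure.pi fun _ : ι i => gaussianReal 0 1) = 0 := by
    rw [hk]
    have : ∀ (a : ∀ i, ι i → ℝ) t, Matrix.det (Matrix.of fun i j => ∑ m, pd (h i m) t j * a i m) = 0 := by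
      intro a t
      apply Matrix.det_eq_zero_of_column_eq_zero j
      intro i
      simp [hpd]
    simp [this]
  rw [lintegral_eq_zero_iff (measurable_count h (fun i m => (hh i m).continuous))] at hz
  filter_upwards [hz] with a ha t ht
  simp only [Pi.zero_apply, ENat.toENNReal_eq_zero, Set.encard_eq_zero] at ha
  have : t ∈ {t | ∀ i, ∑ m, h i m t * a i m = 0} := ht
  rw [ha] at this
  exact this

/-- Row decomposition at fixed `t`. -/
theorem row_decomp (g : ∀ i, ι i → ℝ) (l : ∀ i, Fin n → ι i → ℝ) :
    ∫⁻ a, ENNReal.ofReal |Matrix.det (Matrix.of fun i j => ∑ m, l i j m * a i m)| *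
        ∏ i, gaussianPDF 0 1 (∑ m, g i m * a i m)
        ∂(Measure.pi fun i : Fin n => Measure.pi fun _ : ι i => gaussianReal 0 1)
    = ∫⁻ M, ENNReal.ofReal |Matrix.det (Matrix.of fun i j => (M i j : ℝ))|
        ∂(Measure.pi fun i => rowMeas (g i) (l i)) := by
  have hdet : Measurable fun M : Fin n → Fin n → ℝ => ENNReal.ofReal |Matrix.det (Matrix.of fun i j => (M i j : ℝ))| := by
    apply Measurable.ennreal_ofReal
    apply Continuous.measurable
    apply continuous_abs.comp
    apply Continuous.matrix_det
    exact continuous_id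
  have hlm : ∀ i, Measurable (fun (b : ι i → ℝ) (j : Fin n) => ∑ m, l i j m * b m) := by
    intro i; fun_prop
  have hpm : ∀ i, Measurable fun b : ι i → ℝ => gaussianPDF 0 1 (∑ m, g i m * b m) := fun i =>
    (measurable_gaussianPDF 0 1).comp (by fun_prop)
  unfold rowMeas
  rw [← Measure.pi_map_pi (fun i => (hlm i).aemeasurable),
    pi_withDensity_fin n (fun i => Measure.pi fun _ : ι i => gaussianReal 0 1)
      (fun i b => gaussianPDF 0 1 (∑ m, g i m * b m)) hpm]
  have hLm : Measurable (fun (a : ∀ i, ι i → ℝ) i j => ∑ m, l i j m * a i m) := by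
    rw [measurable_pi_iff]
    intro i
    exact (hlm i).comp (measurable_pi_apply i)
  rw [lintegral_map hdet hLm, lintegral_withDensity_eq_lintegral_mul]
  · apply lintegral_congr
    intro a
    simp only [Pi.mul_apply]
    rw [mul_comm]
  · exact Finset.measurable_prod _ fun i _ => (hpm i).comp (measurable_pi_apply i)
  · exact hdet.comp hLm
end

theorem det_scale {n : ℕ} (R R' : Fin n → Measure (Fin n → ℝ)) [∀ i, IsFiniteMeasure (R i)]
    [∀ i, IsFiniteMeasure (R' i)]
    (c lam : Fin n → ℝ) (hc : ∀ i, 0 ≤ c i) (hl : ∀ i, 0 ≤ lam i)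
    (h : ∀ i, R i = (ENNReal.ofReal (c i)) • (R' i).map (fun x => lam i • x)) :
    ∫⁻ M, ENNReal.ofReal |Matrix.det (Matrix.of fun i j => (M i j : ℝ))| ∂(Measure.pi R)
    = ENNReal.ofReal (∏ i, (c i * lam i)) *
      ∫⁻ M, ENNReal.ofReal |Matrix.det (Matrix.of fun i j => (M i j : ℝ))| ∂(Measure.pi R') := by
  have hdet : Measurable fun M : Fin n → Fin n → ℝ => ENNReal.ofReal |Matrix.det (Matrix.of fun i j => (M i j : ℝ))| := by
    apply Measurable.ennreal_ofReal
    apply Continuous.measurable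
    apply continuous_abs.comp
    apply Continuous.matrix_det
    exact continuous_id
  have h' : R = fun i => ((R' i).map (fun x => lam i • x)).withDensity (fun _ => ENNReal.ofReal (c i)) := by
    funext i
    rw [withDensity_const, h i]
  have : ∀ i, SigmaFinite (((R' i).map (fun x => lam i • x)).withDensity (fun _ => ENNReal.ofReal (c i))) := by
    intro i
    have h'' := congrFun h' i
    rw [← h'']; infer_instance
  have hsm : ∀ i, Measurable (fun x : Fin n → ℝ => lam i • x) := fun i => by fun_prop
  have hSm : Measurable (fun (M : Fin n → Fin n → ℝ) i => lam i • M i) := by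
    rw [measurable_pi_iff]
    intro i
    exact (hsm i).comp (measurable_pi_apply i)
  rw [h', pi_withDensity_fin n (fun i => (R' i).map (fun x => lam i • x)) _ (fun i => measurable_const),
    withDensity_const, lintegral_smul_measure, ← Measure.pi_map_pi (fun i => (hsm i).aemeasurable),
    lintegral_map hdet hSm]
  have h3 : ∀ M : Fin n → Fin n → ℝ, ENNReal.ofReal |Matrix.det (Matrix.of fun i j => ((lam i • M i) j : ℝ))|
      = ENNReal.ofReal (∏ i, lam i) * ENNReal.ofReal |Matrix.det (Matrix.of fun i j => (M i j : ℝ))| := by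
    intro M
    rw [← ENNReal.ofReal_mul (Finset.prod_nonneg fun i _ => hl i)]
    congr 1
    have := Matrix.det_mul_column lam (Matrix.of fun i j => (M i j : ℝ))
    simp only [Matrix.of_apply] at this
    simp only [Pi.smul_apply, smul_eq_mul]
    rw [this, abs_mul, abs_of_nonneg (Finset.prod_nonneg fun i _ => hl i)]
  simp_rw [h3]
  rw [lintegral_const_mul _ hdet, Finset.prod_mul_distrib,
    ENNReal.ofReal_mul (Finset.prod_nonneg fun i _ => hc i), ENNReal.ofReal_prod_of_nonneg (fun i _ => hc i),
    smul_eq_mul, mul_assoc]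

open MeasureTheory ProbabilityTheory

/-- Weighted Veronese monomials. -/
noncomputable def ver {k d : ℕ} (m : Sym (Fin k) d) (x : Fin k → ℝ) : ℝ :=
  Real.sqrt (Nat.multinomial Finset.univ fun i => Multiset.count i (m : Multiset (Fin k))) *
    ∏ i, x i ^ Multiset.count i (m : Multiset (Fin k))

theorem multinomial_univ_count {k : ℕ} (m : Multiset (Fin k)) :
    Nat.multinomial Finset.univ (fun i => Multiset.count i m) = m.countPerms := by
  rw [Multiset.countPerms, Finsupp.multinomial, Nat.multinomial, Finsupp.sum_fintype _ _ (by simp),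
    Finsupp.prod_fintype _ _ (by simp)]
  simp

theorem ver_kernel {k d : ℕ} (x y : Fin k → ℝ) :
    ∑ m : Sym (Fin k) d, ver m x * ver m y = (∑ i, x i * y i) ^ d := by
  rw [Finset.sum_pow, Finset.sym_univ]
  refine Finset.sum_congr rfl fun m _ => ?_
  unfold ver
  rw [multinomial_univ_count]
  have h1 : ((m.val.map fun i => x i * y i).prod : ℝ)
      = ∏ i, (x i * y i) ^ Multiset.count i (m : Multiset (Fin k)) := by
    rw [Finset.prod_multiset_map_count]
    apply Finset.prod_subset (Finset.subset_univ _)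
    intro i _ hi
    have : Multiset.count i (m : Multiset (Fin k)) = 0 := by
      rw [Multiset.count_eq_zero]; simpa using hi
    simp [this]
  rw [h1]
  simp_rw [mul_pow, Finset.prod_mul_distrib]
  have h2 := Real.mul_self_sqrt (Nat.cast_nonneg (α := ℝ) (m.val.countPerms))
  change √(m.val.countPerms : ℝ) * _ * (√(m.val.countPerms : ℝ) * _) = _
  linear_combination (∏ i, x i ^ Multiset.count i (m : Multiset (Fin k))) * (∏ i, y i ^ Multiset.count i (m : Multiset (Fin k))) * h2

theorem ver_replicate {k d : ℕ} (j : Fin k) (x : Fin k → ℝ) :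
    ver (Sym.replicate d j) x = x j ^ d := by
  unfold ver
  rw [Sym.coe_replicate]
  have h1 : ∏ i, x i ^ Multiset.count i (Multiset.replicate d j) = x j ^ d := by
    rw [Finset.prod_eq_single j]
    · simp
    · intro i _ hi
      rw [Multiset.count_replicate, if_neg (Ne.symm hi), pow_zero]
    · simp
  have h2 : Nat.multinomial Finset.univ (fun i => Multiset.count i (Multiset.replicate d j)) = 1 := by
    unfold Nat.multinomial
    have e1 : ∑ i, Multiset.count i (Multiset.replicate d j) = d := by
      rw [Finset.sum_eq_single j]
      · simp
      · intro i _ hi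
        rw [Multiset.count_replicate, if_neg (Ne.symm hi)]
      · simp
    have e2 : ∏ i, (Multiset.count i (Multiset.replicate d j)).factorial = d.factorial := by
      rw [Finset.prod_eq_single j]
      · simp
      · intro i _ hi
        rw [Multiset.count_replicate, if_neg (Ne.symm hi), Nat.factorial_zero]
      · simp
    rw [e1, e2, Nat.div_self (Nat.factorial_pos d)]
  rw [h1, h2]
  simp

theorem ver_contDiff {k d : ℕ} (m : Sym (Fin k) d) : ContDiff ℝ 1 (ver m) := by
  unfold ver
  fun_prop

theorem ver_smul {k d : ℕ} (m : Sym (Fin k) d) (c : ℝ) (x : Fin k → ℝ) :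
    ver m (c • x) = c ^ d * ver m x := by
  unfold ver
  simp only [Pi.smul_apply, smul_eq_mul, mul_pow, Finset.prod_mul_distrib]
  have : ∏ i : Fin k, c ^ Multiset.count i (m : Multiset (Fin k)) = c ^ d := by
    rw [Finset.prod_pow_eq_pow_sum, Multiset.sum_count_eq_card (by simp)]
    simp
  rw [this]; ring

/-- affine chart -/
noncomputable def vt {n d : ℕ} (m : Sym (Fin (n + 1)) d) (t : Fin n → ℝ) : ℝ := ver m (Fin.cons 1 t)

theorem vt_contDiff {n d : ℕ} (m : Sym (Fin (n + 1)) d) : ContDiff ℝ 1 (vt (n := n) m) := by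
  unfold vt
  apply (ver_contDiff m).comp
  rw [contDiff_pi]
  intro i
  refine Fin.cases ?_ (fun i => ?_) i
  · simp only [Fin.cons_zero]; fun_prop
  · simp only [Fin.cons_succ]; fun_prop

theorem vt_kernel {n d : ℕ} (t u : Fin n → ℝ) :
    ∑ m : Sym (Fin (n + 1)) d, vt m t * vt m u = (1 + ∑ i, t i * u i) ^ d := by
  unfold vt
  rw [ver_kernel, Fin.sum_univ_succ]
  simp

theorem vt_line {n d : ℕ} (m : Sym (Fin (n + 1)) d) (t ξ : Fin n → ℝ) :
    HasDerivAt (fun s : ℝ => vt m (t + s • ξ)) (fderiv ℝ (vt m) t ξ) 0 :=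
  ((vt_contDiff m).differentiable one_ne_zero t).hasFDerivAt.hasLineDerivAt ξ

theorem dot_line {n : ℕ} (t u ξ : Fin n → ℝ) :
    HasDerivAt (fun s : ℝ => 1 + ∑ i, t i * (u + s • ξ) i) (∑ i, t i * ξ i) 0 := by
  have : (fun s : ℝ => 1 + ∑ i, t i * (u + s • ξ) i) = fun s => s * (∑ i, t i * ξ i) + (1 + ∑ i, t i * u i) := by
    funext s
    rw [Finset.mul_sum]
    have : ∑ i, t i * (u + s • ξ) i = ∑ i, s * (t i * ξ i) + ∑ i, t i * u i := by
      rw [← Finset.sum_add_distrib]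
      refine Finset.sum_congr rfl fun i _ => ?_
      simp only [Pi.add_apply, Pi.smul_apply, smul_eq_mul]; ring
    rw [this]; ring
  rw [this]
  simpa using ((hasDerivAt_id (0 : ℝ)).mul_const (∑ i, t i * ξ i)).add_const (1 + ∑ i, t i * u i)

theorem vt_kernel1 {n d : ℕ} (t u ξ : Fin n → ℝ) :
    ∑ m : Sym (Fin (n + 1)) d, vt m t * fderiv ℝ (vt m) u ξ
      = d * (1 + ∑ i, t i * u i) ^ (d - 1) * ∑ i, t i * ξ i := by
  have h1 : HasDerivAt (fun s : ℝ => ∑ m : Sym (Fin (n + 1)) d, vt m t * vt m (u + s • ξ))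
      (∑ m : Sym (Fin (n + 1)) d, vt m t * fderiv ℝ (vt m) u ξ) 0 :=
    HasDerivAt.fun_sum fun m _ => (vt_line m u ξ).const_mul _
  simp_rw [vt_kernel] at h1
  have h2 := (dot_line t u ξ).pow d
  simpa using h1.unique h2

theorem vt_kernel2 {n d : ℕ} (t u ξ η : Fin n → ℝ) :
    ∑ m : Sym (Fin (n + 1)) d, fderiv ℝ (vt m) t η * fderiv ℝ (vt m) u ξ
      = d * ((d - 1 : ℕ) * (1 + ∑ i, t i * u i) ^ (d - 1 - 1) * (∑ i, u i * η i)) * (∑ i, t i * ξ i)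
        + d * (1 + ∑ i, t i * u i) ^ (d - 1) * ∑ i, η i * ξ i := by
  have h1 : HasDerivAt (fun s : ℝ => ∑ m : Sym (Fin (n + 1)) d, vt m (t + s • η) * fderiv ℝ (vt m) u ξ)
      (∑ m : Sym (Fin (n + 1)) d, fderiv ℝ (vt m) t η * fderiv ℝ (vt m) u ξ) 0 :=
    HasDerivAt.fun_sum fun m _ => (vt_line m t η).mul_const _
  simp_rw [vt_kernel1] at h1
  have h2 := (dot_line u t η).pow (d - 1)
  have h3 : HasDerivAt (fun s : ℝ => ∑ i, (t + s • η) i * ξ i) (∑ i, η i * ξ i) 0 := by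
    have := (dot_line ξ t η).sub_const 1
    simp only [add_sub_cancel_left] at this
    simpa only [mul_comm] using this
  have h4 := (h2.const_mul (d : ℝ)).mul h3
  have h5 := h1.unique (h4.congr_of_eventuallyEq (Filter.Eventually.of_forall fun s => by
    simp [mul_comm (u _)]))
  rw [h5]
  simp [mul_comm (u _)]

/-- Comparison of the row measure in degree `d` with degree one. -/
theorem row_compare_vt {n d : ℕ} (hd : 1 ≤ d) (t : Fin n → ℝ) :
    rowMeas (fun m : Sym (Fin (n + 1)) d => if m = Sym.replicate d 0 then 0 else vt m t)
        (fun j m => pd (vt m) t j)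
      = ENNReal.ofReal (√((1 + ∑ i, t i * t i) ^ (d - 1)))⁻¹ •
        (rowMeas t (fun j i => if i = j then 1 else 0)).map
          (fun x => √(d * (1 + ∑ i, t i * t i) ^ (d - 1)) • x) := by
  have hs : 0 < 1 + ∑ i, t i * t i := by
    have : 0 ≤ ∑ i, t i * t i := Finset.sum_nonneg fun i _ => mul_self_nonneg _
    linarith
  have hv0 : vt (n := n) (Sym.replicate d 0) = fun _ => 1 := by
    funext t; unfold vt; rw [ver_replicate]; simp
  have hfd : ∀ (m : Sym (Fin (n + 1)) d) (ξ : Fin n → ℝ), ∑ j, ξ j * pd (vt m) t j = fderiv ℝ (vt m) t ξ := by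
    intro m ξ
    conv_rhs => rw [← Finset.univ_sum_single ξ, map_sum]
    refine Finset.sum_congr rfl fun j _ => ?_
    have : (Pi.single j (ξ j) : Fin n → ℝ) = ξ j • Pi.single j 1 := by
      rw [← Pi.single_smul]; simp
    rw [this, map_smul, smul_eq_mul, pd]
  have hA : 1 + ∑ m : Sym (Fin (n + 1)) d, (if m = Sym.replicate d 0 then 0 else vt m t) ^ 2
      = (1 + ∑ i, t i * t i) ^ d := by
    rw [← vt_kernel, ← Finset.add_sum_erase _ _ (Finset.mem_univ (Sym.replicate d 0)),
        ← Finset.add_sum_erase _ (fun m => vt m t * vt m t) (Finset.mem_univ (Sym.replicate d 0))]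
    simp only [if_true, hv0]
    have : ∀ m ∈ Finset.univ.erase (Sym.replicate d (0 : Fin (n + 1))),
        (if m = Sym.replicate d 0 then 0 else vt m t) ^ 2 = vt m t * vt m t := by
      intro m hm
      rw [if_neg (Finset.ne_of_mem_erase hm), sq]
    rw [Finset.sum_congr rfl this]
    ring
  have hB : ∀ ξ : Fin n → ℝ, ∑ m : Sym (Fin (n + 1)) d, (if m = Sym.replicate d 0 then 0 else vt m t) * fderiv ℝ (vt m) t ξ
      = d * (1 + ∑ i, t i * t i) ^ (d - 1) * ∑ i, t i * ξ i := by
    intro ξ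
    rw [← vt_kernel1]
    refine Finset.sum_congr rfl fun m _ => ?_
    by_cases hm : m = Sym.replicate d 0
    · subst hm
      rw [hv0]; simp
    · rw [if_neg hm]
  apply rowMeas_compare _ _ _ _ _ _ (by positivity)
  · rw [hA]
    have : ∑ i, t i ^ 2 = ∑ i, t i * t i := Finset.sum_congr rfl fun i _ => sq _
    rw [this, ← mul_inv, ← Real.sqrt_mul (by positivity), ← pow_succ, Nat.sub_add_cancel hd]
  · intro ξ
    simp_rw [hfd]
    rw [hA, hB]
    have hC : ∑ m : Sym (Fin (n + 1)) d, (fderiv ℝ (vt m) t ξ) ^ 2 = _ :=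
      (Finset.sum_congr rfl fun m _ => sq _).trans (vt_kernel2 t t ξ ξ)
    rw [hC, Real.sq_sqrt (by positivity)]
    have e1 : ∀ i, ∑ j, ξ j * (if i = j then (1 : ℝ) else 0) = ξ i := by intro i; simp
    simp_rw [e1]
    have e2 : ∑ i, t i ^ 2 = ∑ i, t i * t i := Finset.sum_congr rfl fun i _ => sq _
    have e3 : ∑ i, ξ i * ξ i = ∑ i, ξ i ^ 2 := Finset.sum_congr rfl fun i _ => (sq _).symm
    rw [e2, e3]
    set s := 1 + ∑ i, t i * t i
    set q := ∑ i, t i * ξ i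
    obtain ⟨e, rfl⟩ : ∃ e, d = e + 1 := ⟨d - 1, (Nat.sub_add_cancel hd).symm⟩
    rw [Nat.add_sub_cancel]
    rcases e with _ | e
    · simp
    · rw [Nat.add_sub_cancel]
      have : s ≠ 0 := hs.ne'
      push_cast
      field_simp
      ring

open MeasureTheory ProbabilityTheory

theorem swap_rows {n : ℕ} {ι : Fin n → Type} [∀ i, Fintype (ι i)] [∀ i, DecidableEq (ι i)]
    (g : ∀ i, ι i → (Fin n → ℝ) → ℝ) (l : ∀ i, Fin n → ι i → (Fin n → ℝ) → ℝ)
    (hg : ∀ i m, Continuous (g i m)) (hl : ∀ i j m, Continuous (l i j m)) :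
    ∫⁻ a, (∫⁻ t, ENNReal.ofReal |Matrix.det (Matrix.of fun i j => ∑ m, l i j m t * a i m)| *
        ∏ i, gaussianPDF 0 1 (∑ m, g i m t * a i m))
        ∂(Measure.pi fun i : Fin n => Measure.pi fun _ : ι i => gaussianReal 0 1)
    = ∫⁻ t, ∫⁻ M, ENNReal.ofReal |Matrix.det (Matrix.of fun i j => (M i j : ℝ))|
        ∂(Measure.pi fun i => rowMeas (fun m => g i m t) (fun j m => l i j m t)) := by
  rw [lintegral_lintegral_swap]
  · apply lintegral_congr
    intro t
    exact row_decomp (fun i m => g i m t) (fun i j m => l i j m t)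
  · apply Measurable.aemeasurable
    apply Measurable.mul
    · apply Measurable.ennreal_ofReal
      apply Continuous.measurable
      apply continuous_abs.comp
      apply Continuous.matrix_det
      refine continuous_pi fun i => continuous_pi fun j => ?_
      refine continuous_finsetSum _ fun m _ => ?_
      have := hl i j m
      fun_prop
    · refine Finset.measurable_prod _ fun i _ => ?_
      apply (measurable_gaussianPDF 0 1).comp
      apply Continuous.measurable
      refine continuous_finsetSum _ fun m _ => ?_
      have := hg i m
      fun_prop

theorem det_ne_zero_ae (n : ℕ) :
    ∀ᵐ A ∂(Measure.pi fun _ : Fin n => Measure.pi fun _ : Fin n => gaussianReal 0 1),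
      Matrix.det (Matrix.of fun i j => (A i j : ℝ)) ≠ 0 := by
  have h1 : ∀ j : Fin n, ∀ᵐ A ∂(Measure.pi fun _ : Fin n => Measure.pi fun _ : Fin n => gaussianReal 0 1),
      ∀ t : Fin n → ℝ, ¬ ∀ i : Fin n, ∑ m, (Function.update t j 1) m * A i m = 0 := by
    intro j
    refine no_zero (ι := fun _ => Fin n) (fun _ m t => Function.update t j 1 m) ?_ (fun _ => j) ?_ j ?_
    · intro i m
      by_cases h : m = j
      · subst h; simp only [Function.update_self]; fun_prop
      · simp only [Function.update_of_ne h]; fun_prop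
    · intro i t; simp
    · intro i m t s; simp
  filter_upwards [ae_all_iff.2 h1] with A hA hdet
  obtain ⟨v, hv, hv2⟩ := Matrix.exists_mulVec_eq_zero_iff.2 hdet
  obtain ⟨j, hj⟩ := Function.ne_iff.1 hv
  apply hA j ((v j)⁻¹ • v)
  intro i
  have h2 : Function.update ((v j)⁻¹ • v) j 1 = (v j)⁻¹ • v := by
    rw [Function.update_eq_self_iff]
    simp only [Pi.smul_apply, smul_eq_mul]
    exact (inv_mul_cancel₀ hj).symm
  rw [h2]
  have h3 := congrFun hv2 i
  simp only [Matrix.mulVec, dotProduct, Matrix.of_apply, Pi.zero_apply] at h3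
  simp only [Pi.smul_apply, smul_eq_mul]
  rw [← mul_zero (v j)⁻¹, ← h3, Finset.mul_sum]
  exact Finset.sum_congr rfl fun m _ => by ring

theorem gauss_total (n : ℕ) : ∫⁻ x : Fin n → ℝ, ∏ i, gaussianPDF 0 1 (x i) = 1 := by
  have := pi_gauss_density n
  have h2 := congrArg (fun μ => μ Set.univ) this
  simp only [measure_univ, withDensity_apply _ MeasurableSet.univ, Measure.restrict_univ] at h2
  exact h2.symm

theorem linear_change {n : ℕ} (A : Fin n → Fin n → ℝ)
    (hA : Matrix.det (Matrix.of fun i j => (A i j : ℝ)) ≠ 0) :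
    ∫⁻ t : Fin n → ℝ, ENNReal.ofReal |Matrix.det (Matrix.of fun i j => (A i j : ℝ))| *
      ∏ i, gaussianPDF 0 1 (∑ m, t m * A i m) = 1 := by
  set B : Matrix (Fin n) (Fin n) ℝ := Matrix.of fun i j => (A i j : ℝ) with hB
  set L : (Fin n → ℝ) →L[ℝ] (Fin n → ℝ) := (Matrix.toLin' B).toContinuousLinearMap with hL
  have hLap : ∀ t, L t = B.mulVec t := fun t => by simp [hL]
  have hpm : Measurable fun x : Fin n → ℝ => ∏ i, gaussianPDF 0 1 (x i) :=
    Finset.measurable_prod _ fun i _ => (measurable_gaussianPDF 0 1).comp (measurable_pi_apply i)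
  have := area_formula_multiplicity volume (fun t => L t) (fun _ => L) (fun x => L.hasStrictFDerivAt)
    continuous_const _ hpm
  have hdet : L.det = B.det := by
    rw [ContinuousLinearMap.det, hL]
    simp
  rw [hdet] at this
  have hbij : ∀ y, ((fun t => L t) ⁻¹' {y}).encard = 1 := by
    intro y
    rw [Set.encard_eq_one]
    have hu : IsUnit B.det := isUnit_iff_ne_zero.2 hA
    refine ⟨B⁻¹.mulVec y, ?_⟩
    ext t
    simp only [Set.mem_preimage, Set.mem_singleton_iff, hLap]
    constructor
    · rintro rfl
      rw [Matrix.mulVec_mulVec, Matrix.nonsing_inv_mul _ hu, Matrix.one_mulVec]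
    · rintro rfl
      rw [Matrix.mulVec_mulVec, Matrix.mul_nonsing_inv _ hu, Matrix.one_mulVec]
  simp only [hbij, ENat.toENNReal_one, one_mul] at this
  rw [gauss_total] at this
  rw [this]
  refine lintegral_congr fun t => ?_
  congr 1
  refine Finset.prod_congr rfl fun i _ => ?_
  rw [hLap]
  simp only [Matrix.mulVec, dotProduct, hB, Matrix.of_apply]
  congr 1
  exact Finset.sum_congr rfl fun m _ => by ring

theorem reference_integral (n : ℕ) :
    ∫⁻ t : Fin n → ℝ, ∫⁻ M, ENNReal.ofReal |Matrix.det (Matrix.of fun i j => (M i j : ℝ))|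
        ∂(Measure.pi fun _ : Fin n => rowMeas t (fun j i : Fin n => if i = j then (1 : ℝ) else 0)) = 1 := by
  have h := swap_rows (n := n) (ι := fun _ => Fin n) (fun _ m t => t m)
    (fun _ j m _ => if m = j then (1 : ℝ) else 0) (fun _ m => continuous_apply m)
    (fun _ _ _ => continuous_const)
  refine h.symm.trans ?_
  have h2 : ∀ᵐ A ∂(Measure.pi fun _ : Fin n => Measure.pi fun _ : Fin n => gaussianReal 0 1),
      (∫⁻ t : Fin n → ℝ, ENNReal.ofReal |Matrix.det (Matrix.of fun i j => ∑ m, (if m = j then (1 : ℝ) else 0) * A i m)| *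
        ∏ i, gaussianPDF 0 1 (∑ m, t m * A i m)) = 1 := by
    filter_upwards [det_ne_zero_ae n] with A hA
    have := linear_change A hA
    simpa using this
  rw [lintegral_congr_ae h2]
  simp

theorem main_lintegral {n : ℕ} (d : Fin n → ℕ) (hd : ∀ i, 1 ≤ d i) :
    ∫⁻ a, (({t : Fin n → ℝ | ∀ i, ∑ m, vt m t * a i m = 0}.encard : ℕ∞) : ENNReal)
      ∂(Measure.pi fun i : Fin n => Measure.pi fun _ : Sym (Fin (n + 1)) (d i) => gaussianReal 0 1)
    = ENNReal.ofReal (Real.sqrt (∏ i, (d i : ℝ))) := by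
  rw [kac_rice (ι := fun i => Sym (Fin (n + 1)) (d i)) (fun i m => vt m) (fun i m => vt_contDiff m)
    (fun i => Sym.replicate (d i) 0) (fun i t => by simp [vt, ver_replicate])]
  rw [swap_rows (ι := fun i => Sym (Fin (n + 1)) (d i))
    (fun i m t => if m = Sym.replicate (d i) 0 then 0 else vt m t) (fun i j m t => pd (vt m) t j)]
  · have key : ∀ t : Fin n → ℝ, ∫⁻ M, ENNReal.ofReal |Matrix.det (Matrix.of fun i j => (M i j : ℝ))|
        ∂(Measure.pi fun i => rowMeas (fun m : Sym (Fin (n + 1)) (d i) => if m = Sym.replicate (d i) 0 then 0 else vt m t)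
          (fun j m => pd (vt m) t j)) = ENNReal.ofReal (Real.sqrt (∏ i, (d i : ℝ))) *
          ∫⁻ M, ENNReal.ofReal |Matrix.det (Matrix.of fun i j => (M i j : ℝ))|
        ∂(Measure.pi fun _ : Fin n => rowMeas t (fun j i : Fin n => if i = j then (1 : ℝ) else 0)) := by
      intro t
      rw [det_scale _ _ _ _ (fun i => ?_) (fun i => ?_) (fun i => row_compare_vt (hd i) t)]
      · congr 2
        have hs : 0 < 1 + ∑ i, t i * t i := by
          have : 0 ≤ ∑ i, t i * t i := Finset.sum_nonneg fun i _ => mul_self_nonneg _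
          linarith
        rw [Real.sqrt_eq_rpow, ← Real.finsetProd_rpow _ _ (fun i _ => by positivity)]
        refine Finset.prod_congr rfl fun i _ => ?_
        rw [← Real.sqrt_eq_rpow, Real.sqrt_mul (by positivity)]
        have h0 : √((1 + ∑ i, t i * t i) ^ (d i - 1)) ≠ 0 := by positivity
        field_simp
      · positivity
      · positivity
    rw [lintegral_congr key, lintegral_const_mul' _ _ ENNReal.ofReal_ne_top, reference_integral, mul_one]
  · intro i m
    by_cases h : m = Sym.replicate (d i) 0
    · simp only [h, if_true]; exact continuous_const
    · simp only [h, if_false]; exact (vt_contDiff m).continuous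
  · intro i j m
    unfold pd
    exact ((vt_contDiff m).continuous_fderiv one_ne_zero).clm_apply continuous_const

theorem bwSystem_eq {n : ℕ} (d : Fin n → ℕ) (a : (i : Fin n) → Sym (Fin (n + 1)) (d i) → ℝ)
    (x : Fin (n + 1) → ℝ) (i : Fin n) : bwSystem d a x i = ∑ m, ver m x * a i m := by
  unfold bwSystem ver
  exact Finset.sum_congr rfl fun m _ => by ring

theorem bwSystem_smul {n : ℕ} (d : Fin n → ℕ) (a : (i : Fin n) → Sym (Fin (n + 1)) (d i) → ℝ)
    (c : ℝ) (x : Fin (n + 1) → ℝ) (i : Fin n) :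
    bwSystem d a (c • x) i = c ^ d i * bwSystem d a x i := by
  simp only [bwSystem_eq, ver_smul, Finset.mul_sum, mul_assoc]

theorem no_infinity {n : ℕ} (d : Fin n → ℕ) :
    ∀ᵐ a ∂(Measure.pi fun i : Fin n => Measure.pi fun _ : Sym (Fin (n + 1)) (d i) => gaussianReal 0 1),
      ∀ x : Fin (n + 1) → ℝ, x ≠ 0 → (∀ i, bwSystem d a x i = 0) → x 0 ≠ 0 := by
  have h1 : ∀ j : Fin n, ∀ᵐ a ∂(Measure.pi fun i : Fin n => Measure.pi fun _ : Sym (Fin (n + 1)) (d i) => gaussianReal 0 1),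
      ∀ t : Fin n → ℝ, ¬ ∀ i : Fin n, ∑ m, ver m (Fin.cons 0 (Function.update t j 1) : Fin (n + 1) → ℝ) * a i m = 0 := by
    intro j
    refine no_zero (ι := fun i => Sym (Fin (n + 1)) (d i))
      (fun _ m t => ver m (Fin.cons 0 (Function.update t j 1) : Fin (n + 1) → ℝ)) ?_
      (fun i => Sym.replicate (d i) j.succ) ?_ j ?_
    · intro i m
      refine (ver_contDiff m).comp ?_
      rw [contDiff_pi]
      intro k
      refine Fin.cases ?_ (fun k => ?_) k
      · simp only [Fin.cons_zero]; fun_prop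
      · simp only [Fin.cons_succ]
        by_cases h : k = j
        · subst h; simp only [Function.update_self]; fun_prop
        · simp only [Function.update_of_ne h]; fun_prop
    · intro i t; simp [ver_replicate]
    · intro i m t s; simp
  filter_upwards [ae_all_iff.2 h1] with a ha x hx hz h0
  have : ∃ j : Fin n, x j.succ ≠ 0 := by
    by_contra! hcon
    apply hx
    funext k
    exact Fin.cases h0 hcon k
  obtain ⟨j, hj⟩ := this
  apply ha j (fun k => (x j.succ)⁻¹ * x k.succ)
  intro i
  have h2 : (Fin.cons 0 (Function.update (fun k => (x j.succ)⁻¹ * x k.succ) j 1) : Fin (n + 1) → ℝ)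
      = (x j.succ)⁻¹ • x := by
    funext k
    refine Fin.cases ?_ (fun k => ?_) k
    · simp [h0]
    · by_cases h : k = j
      · subst h; simp [hj]
      · simp [h]
  rw [h2, ← bwSystem_eq, bwSystem_smul, hz i, mul_zero]

theorem card_eq {n : ℕ} (d : Fin n → ℕ) (a : (i : Fin n) → Sym (Fin (n + 1)) (d i) → ℝ)
    (ha : ∀ x : Fin (n + 1) → ℝ, x ≠ 0 → (∀ i, bwSystem d a x i = 0) → x 0 ≠ 0) :
    ((Nat.card {p : Projectivization ℝ (Fin (n + 1) → ℝ) | ∀ i, bwSystem d a p.rep i = 0} : ℕ) : ℝ)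
    = ((({t : Fin n → ℝ | ∀ i, ∑ m, vt m t * a i m = 0}.encard : ℕ∞) : ENNReal)).toReal := by
  have hne : ∀ t : Fin n → ℝ, (Fin.cons 1 t : Fin (n + 1) → ℝ) ≠ 0 := by
    intro t h
    have := congrFun h 0
    simp at this
  have hvt : ∀ t : Fin n → ℝ, ∀ i, ∑ m, vt m t * a i m = bwSystem d a (Fin.cons 1 t) i := by
    intro t i; rw [bwSystem_eq]; rfl
  have hset : {p : Projectivization ℝ (Fin (n + 1) → ℝ) | ∀ i, bwSystem d a p.rep i = 0}
      = (fun t : Fin n → ℝ => Projectivization.mk ℝ (Fin.cons 1 t : Fin (n + 1) → ℝ) (hne t)) ''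
        {t : Fin n → ℝ | ∀ i, ∑ m, vt m t * a i m = 0} := by
    ext p
    constructor
    · intro hp
      have hp' : ∀ i, bwSystem d a p.rep i = 0 := hp
      have h0 := ha p.rep p.rep_nonzero hp'
      have e : (Fin.cons 1 (fun k : Fin n => (p.rep 0)⁻¹ * p.rep k.succ) : Fin (n + 1) → ℝ)
          = (p.rep 0)⁻¹ • p.rep := by
        funext k
        refine Fin.cases ?_ (fun k => ?_) k
        · simp [h0]
        · simp
      refine ⟨fun k => (p.rep 0)⁻¹ * p.rep k.succ, ?_, ?_⟩
      · intro i
        rw [hvt, e, bwSystem_smul, hp' i, mul_zero]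
      · conv_rhs => rw [← p.mk_rep]
        rw [Projectivization.mk_eq_mk_iff']
        exact ⟨(p.rep 0)⁻¹, e.symm⟩
    · rintro ⟨t, ht, rfl⟩ i
      obtain ⟨c, hc⟩ := Projectivization.exists_smul_eq_mk_rep ℝ (Fin.cons 1 t : Fin (n + 1) → ℝ) (hne t)
      dsimp only
      rw [← hc, Units.smul_def, bwSystem_smul, ← hvt, ht i, mul_zero]
  have hinj : Function.Injective
      (fun t : Fin n → ℝ => Projectivization.mk ℝ (Fin.cons 1 t : Fin (n + 1) → ℝ) (hne t)) := by
    intro t s h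
    rw [Projectivization.mk_eq_mk_iff'] at h
    obtain ⟨c, hc⟩ := h
    have h0 := congrFun hc 0
    simp at h0
    subst h0
    funext k
    have := congrFun hc k.succ
    simpa using this.symm
  have h1 : Nat.card {p : Projectivization ℝ (Fin (n + 1) → ℝ) | ∀ i, bwSystem d a p.rep i = 0}
      = {t : Fin n → ℝ | ∀ i, ∑ m, vt m t * a i m = 0}.ncard := by
    rw [hset, Nat.card_coe_set_eq, Set.ncard_image_of_injective _ hinj]
  rw [h1, Set.ncard_def]
  cases {t : Fin n → ℝ | ∀ i, ∑ m, vt m t * a i m = 0}.encard <;> simp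

theorem expected_real_projective_zeros (n : ℕ) (hn : 1 ≤ n) (d : Fin n → ℕ)
    (hd : ∀ i, 1 ≤ d i) :
    ∫ a, ((Nat.card
          {p : Projectivization ℝ (Fin (n + 1) → ℝ) | ∀ i, bwSystem d a p.rep i = 0} : ℕ) : ℝ)
        ∂(Measure.pi fun i : Fin n =>
            Measure.pi fun _ : Sym (Fin (n + 1)) (d i) => ProbabilityTheory.gaussianReal 0 1)
      = Real.sqrt (∏ i, (d i : ℝ)) := by
  have hmeas := measurable_count (ι := fun i => Sym (Fin (n + 1)) (d i)) (fun i m => vt m)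
    (fun i m => (vt_contDiff m).continuous)
  have hL := main_lintegral d hd
  have hfin := ae_lt_top hmeas (by rw [hL]; exact ENNReal.ofReal_ne_top)
  rw [integral_congr_ae ((no_infinity d).mono fun a ha => card_eq d a ha)]
  rw [integral_toReal hmeas.aemeasurable hfin, hL, ENNReal.toReal_ofReal (Real.sqrt_nonneg _)]
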